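/- arXiv:0909.5097 — 4 statements merged into one kernel-verified Lean document; each statement's English description precedes it below -/
import Mathlib

section
/- Let A and B be structures over a relational signature τ, where B is pp-|A|-saturated. Suppose f is a mapping from a subset {a_α : α < μ} of A (with μ < |A|) to B such that every primitive positive sentence over τ augmented with constants c_α (α < μ) that is true in the expansion (A; ⟨a_α⟩_{α<μ}) is also true in (B; ⟨f(a_α)⟩_{α<μ}). Then f can be extended to a homomorphism from A to B. -/
open FirstOrder FirstOrder.Language Cardinal

universe u v w

namespace PaperCSP

variable {L : FirstOrder.Language.{u, v}}

/-- Primitive positive bounded formulas: built from `⊥`, equalities and atomic relations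
using conjunction and existential quantification. -/
inductive IsPP {α : Type w} : ∀ {n : ℕ}, L.BoundedFormula α n → Prop
  | falsum {n} : IsPP (BoundedFormula.falsum : L.BoundedFormula α n)
  | equal {n} (t₁ t₂ : L.Term (α ⊕ Fin n)) : IsPP (BoundedFormula.equal t₁ t₂)
  | rel {n ℓ} (R : L.Relations ℓ) (ts : Fin ℓ → L.Term (α ⊕ Fin n)) :
      IsPP (BoundedFormula.rel R ts)
  | inf {n} {φ ψ : L.BoundedFormula α n} : IsPP φ → IsPP ψ → IsPP (φ ⊓ ψ)
  | ex {n} {φ : L.BoundedFormula α (n + 1)} : IsPP φ → IsPP φ.ex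

/-- Existential positive bounded formulas: additionally closed under disjunction. -/
inductive IsEP {α : Type w} : ∀ {n : ℕ}, L.BoundedFormula α n → Prop
  | falsum {n} : IsEP (BoundedFormula.falsum : L.BoundedFormula α n)
  | equal {n} (t₁ t₂ : L.Term (α ⊕ Fin n)) : IsEP (BoundedFormula.equal t₁ t₂)
  | rel {n ℓ} (R : L.Relations ℓ) (ts : Fin ℓ → L.Term (α ⊕ Fin n)) :
      IsEP (BoundedFormula.rel R ts)
  | inf {n} {φ ψ : L.BoundedFormula α n} : IsEP φ → IsEP ψ → IsEP (φ ⊓ ψ)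
  | sup {n} {φ ψ : L.BoundedFormula α n} : IsEP φ → IsEP ψ → IsEP (φ ⊔ ψ)
  | ex {n} {φ : L.BoundedFormula α (n + 1)} : IsEP φ → IsEP φ.ex

/-- A relation is pp-definable (without parameters) in a structure. -/
def PPDefinable (L : FirstOrder.Language.{u, v}) (A : Type w) [L.Structure A] {m : ℕ} (R : Set ((Fin m) → A)) : Prop :=
  ∃ φ : L.Formula (Fin m), IsPP φ ∧ R = {x | φ.Realize x}

/-- A relation is ep-definable (without parameters) in a structure. -/
def EPDefinable (L : FirstOrder.Language.{u, v}) (A : Type w) [L.Structure A] {m : ℕ} (R : Set ((Fin m) → A)) : Prop :=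
  ∃ φ : L.Formula (Fin m), IsEP φ ∧ R = {x | φ.Realize x}

/-- A relation is first-order definable (without parameters) in a structure. -/
def FODefinable (L : FirstOrder.Language.{u, v}) (A : Type w) [L.Structure A] {m : ℕ} (R : Set ((Fin m) → A)) : Prop :=
  ∃ φ : L.Formula (Fin m), R = {x | φ.Realize x}

/-- The direct power structure on `I → A`: relations hold iff they hold component-wise. -/
instance piStructure (I : Type*) (A : Type w) [L.Structure A] : L.Structure (I → A) where
  funMap f x i := Structure.funMap f fun j => x j i
  RelMap r x := ∀ i, Structure.RelMap r fun j => x j i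

/-- An `m`-ary relation `R` on `A` is preserved by (invariant under) a function
`f : A^I → A` if it is preserved component-wise. -/
def Preserves {A : Type w} {I : Type*} (f : (I → A) → A)
    {m : ℕ} (R : Set (Fin m → A)) : Prop :=
  ∀ a : Fin m → I → A, (∀ i : I, (fun j => a j i) ∈ R) → (fun j => f (a j)) ∈ R

/-- `R` is preserved by all ω-polymorphisms (homomorphisms `A^κ → A`, `κ ≤ ω`). -/
def PreservedByOmegaPolymorphisms (L : FirstOrder.Language.{u, v}) (A : Type w) [L.Structure A] {m : ℕ}
    (R : Set (Fin m → A)) : Prop :=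
  ∀ (I : Type) [Countable I] (f : (I → A) →[L] A), Preserves (f : (I → A) → A) R

/-- The primitive positive theory of a structure: all true pp-sentences together with
the negations of all false pp-sentences. -/
def ppTheory (L : FirstOrder.Language.{u, v}) (A : Type w) [L.Structure A] : L.Theory :=
  {σ | IsPP σ ∧ A ⊨ σ} ∪ {σ | ∃ φ : L.Sentence, IsPP φ ∧ ¬A ⊨ φ ∧ σ = φ.not}

/-- `A` is an existential-positively closed (epc) model of `T`. -/
def IsEPC (T : L.Theory) (A : Type w) [L.Structure A] : Prop :=
  A ⊨ T ∧ ∀ (B : Type w) [L.Structure B], B ⊨ T →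
    ∀ (h : A →[L] B) (k : ℕ) (φ : L.Formula (Fin k)), IsPP φ →
      ∀ a : Fin k → A, φ.Realize (fun i => h (a i)) → φ.Realize a

/-- A structure is a core if every endomorphism is an embedding. -/
def IsCore (L : FirstOrder.Language.{u, v}) (A : Type w) [L.Structure A] : Prop :=
  ∀ h : A →[L] A, Function.Injective h ∧
    ∀ {n : ℕ} (r : L.Relations n) (x : Fin n → A),
      Structure.RelMap r (fun i => h (x i)) → Structure.RelMap r x

/-- A set of formulas in `n` free variables is satisfiable together with the theory `T`. -/
def SatWith (T : L.Theory) {n : ℕ} (Φ : Set (L.Formula (Fin n))) : Prop :=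
  ∃ (N : Type (max u v)) (S : L.Structure N), letI := S
    Nonempty N ∧ N ⊨ T ∧ ∃ b : Fin n → N, ∀ φ ∈ Φ, φ.Realize b

/-- A pp-`n`-type of a theory `T`. -/
def IsPPType (T : L.Theory) {n : ℕ} (p : Set (L.Formula (Fin n))) : Prop :=
  (∀ φ ∈ p, IsPP φ) ∧ SatWith T p

/-- A maximal pp-`n`-type of a theory `T`. -/
def IsMaximalPPType (T : L.Theory) {n : ℕ} (p : Set (L.Formula (Fin n))) : Prop :=
  IsPPType T p ∧ ∀ φ : L.Formula (Fin n), IsPP φ → φ ∉ p → ¬SatWith T (insert φ p)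

/-- `B` is pp-`κ`-saturated: over any set of fewer than `κ` parameters, every set of
pp-formulas in one free variable all of whose finite subsets are realised (i.e. every
pp-1-type of the expansion) is realised. -/
def IsPPSaturated (L : FirstOrder.Language.{u, v}) (κ : Cardinal.{w}) (B : Type w) [L.Structure B] : Prop :=
  ∀ (β : Type w), #β < κ → ∀ (v : β → B) (p : Set (L.Formula (β ⊕ Unit))),
    (∀ φ ∈ p, IsPP φ) →
    (∀ s : Finset (L.Formula (β ⊕ Unit)), ↑s ⊆ p →
        ∃ c : B, ∀ φ ∈ s, Formula.Realize φ (Sum.elim v fun _ => c)) →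
    ∃ c : B, ∀ φ ∈ p, Formula.Realize φ (Sum.elim v fun _ => c)

/-- `B` is `κ`-saturated: over any set of fewer than `κ` parameters, every set of
formulas in one free variable all of whose finite subsets are realised (i.e. every
1-type of the expansion) is realised. -/
def IsSaturated (L : FirstOrder.Language.{u, v}) (κ : Cardinal.{w}) (B : Type w) [L.Structure B] : Prop :=
  ∀ (β : Type w), #β < κ → ∀ (v : β → B) (p : Set (L.Formula (β ⊕ Unit))),
    (∀ s : Finset (L.Formula (β ⊕ Unit)), ↑s ⊆ p →
        ∃ c : B, ∀ φ ∈ s, Formula.Realize φ (Sum.elim v fun _ => c)) →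
    ∃ c : B, ∀ φ ∈ p, Formula.Realize φ (Sum.elim v fun _ => c)

/-- The homomorphism lifting property. -/
def HomLifting (L : FirstOrder.Language.{u, v}) (M : Type w) [L.Structure M] : Prop :=
  ∀ (k : ℕ) (a : Fin k → (ℕ → M)) (b : Fin k → M),
    (∀ φ : L.Formula (Fin k), IsPP φ →
        Formula.Realize (M := ℕ → M) φ a → Formula.Realize φ b) →
    ∃ f : (ℕ → M) →[L] M, ∀ i, f (a i) = b i

/-- A function `f : A^α → A` is essentially unary. -/
def EssentiallyUnary {A : Type w} {α : Type*} (f : (α → A) → A) : Prop :=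
  ∃ (β : α) (g : A → A), ∀ x : α → A, f x = g (x β)



theorem IsPP.castLE' {α : Type w} {m : ℕ} {φ : L.BoundedFormula α m} (h : IsPP φ) :
    ∀ {n : ℕ} (hmn : m ≤ n), IsPP (φ.castLE hmn) := by
  induction h with
  | falsum => intros; exact .falsum
  | equal => intros; exact .equal _ _
  | rel => intros; exact .rel _ _
  | inf _ _ ih1 ih2 => intro n hmn; exact .inf (ih1 hmn) (ih2 hmn)
  | ex _ ih => intro n hmn; exact .ex (ih (Nat.succ_le_succ hmn))

theorem IsPP.relabel' {α : Type w} {β : Type w} {m k : ℕ} {φ : L.BoundedFormula α k}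
    (h : IsPP φ) (g : α → β ⊕ Fin m) : IsPP (φ.relabel g) := by
  induction h with
  | falsum => exact .falsum
  | equal => exact .equal _ _
  | rel => exact .rel _ _
  | inf _ _ ih1 ih2 => exact .inf ih1 ih2
  | ex _ ih => rw [BoundedFormula.relabel_ex]; exact .ex ih

theorem IsPP.restrict' {α : Type w} [DecidableEq α] {β : Type w} {k : ℕ} {φ : L.BoundedFormula α k}
    (h : IsPP φ) : ∀ (g : φ.freeVarFinset → β), IsPP (φ.restrictFreeVar g) := by
  induction h with
  | falsum => intro g; exact .falsum
  | equal => intro g; exact .equal _ _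
  | rel => intro g; exact .rel _ _
  | inf _ _ ih1 ih2 => intro g; exact .inf (ih1 _) (ih2 _)
  | ex _ ih => intro g; exact .ex (ih _)

/-- A graph (set of pairs) that preserves pp-formulas. -/
def GoodGraph (L : FirstOrder.Language.{u, v}) {A B : Type w} [L.Structure A] [L.Structure B]
    (G : Set (A × B)) : Prop :=
  ∀ φ : L.Formula G, IsPP φ → φ.Realize (fun z => z.1.1) → φ.Realize (fun z => z.1.2)

theorem GoodGraph.sUnion {A B : Type w} [L.Structure A] [L.Structure B]
    {c : Set (Set (A × B))} (hc : IsChain (· ⊆ ·) c) (hne : c.Nonempty)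
    (hg : ∀ G ∈ c, GoodGraph L G) : GoodGraph L (⋃₀ c) := by
  classical
  intro φ hφ hr
  have : ∃ G ∈ c, ((φ.freeVarFinset.image Subtype.val : Finset (A × B)) : Set (A × B)) ⊆ G := by
    refine DirectedOn.exists_mem_subset_of_finset_subset_biUnion (f := id) hne hc.directedOn ?_
    intro z hz
    simp only [Finset.coe_image, Set.mem_image] at hz
    obtain ⟨y, _, rfl⟩ := hz
    obtain ⟨G, hG, hy⟩ := y.2
    exact Set.mem_biUnion hG hy
  obtain ⟨G, hG, hsub⟩ := this
  let f : φ.freeVarFinset → G := fun z => ⟨z.1.1, hsub (by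
    simp only [Finset.coe_image, Set.mem_image]; exact ⟨z.1, z.2, rfl⟩)⟩
  have h1 := hg G hG (BoundedFormula.restrictFreeVar φ f) (hφ.restrict' f)
  have e1 : Formula.Realize (BoundedFormula.restrictFreeVar φ f) (fun z : G => z.1.1) ↔
      φ.Realize (fun z => z.1.1) :=
    BoundedFormula.realize_restrictFreeVar (M := A) (φ := φ) (f := f) _ (fun _ => rfl)
  have e2 : Formula.Realize (BoundedFormula.restrictFreeVar φ f) (fun z : G => z.1.2) ↔
      φ.Realize (fun z => z.1.2) :=
    BoundedFormula.realize_restrictFreeVar (M := B) (φ := φ) (f := f) _ (fun _ => rfl)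
  exact e2.1 (h1 (e1.2 hr))

theorem exists_pp_conj {A B : Type w} [L.Structure A] [L.Structure B] {β : Type w}
    (s : Finset (L.Formula (β ⊕ Unit))) (hs : ∀ φ ∈ s, IsPP φ) :
    ∃ ψ : L.Formula (β ⊕ Unit), IsPP ψ ∧
      (∀ w : β ⊕ Unit → A, ψ.Realize w ↔ ∀ φ ∈ s, φ.Realize w) ∧
      (∀ w : β ⊕ Unit → B, ψ.Realize w ↔ ∀ φ ∈ s, φ.Realize w) := by
  classical
  induction s using Finset.induction_on with
  | empty =>
    refine ⟨BoundedFormula.equal (Term.var (Sum.inl (Sum.inr ())))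
      (Term.var (Sum.inl (Sum.inr ()))), .equal _ _, ?_, ?_⟩ <;>
    · intro w
      simp [Formula.Realize, BoundedFormula.Realize]
  | insert φ s _ ih =>
    obtain ⟨ψ, h1, h2, h3⟩ := ih (fun φ h => hs φ (Finset.mem_insert_of_mem h))
    refine ⟨φ ⊓ ψ, .inf (hs φ (Finset.mem_insert_self _ _)) h1, ?_, ?_⟩
    · intro w; rw [Formula.realize_inf, h2]; simp
    · intro w; rw [Formula.realize_inf, h3]; simp

theorem GoodGraph.extend {A B : Type w} [L.Structure A] [L.Structure B]
    {κ : Cardinal.{w}} (hB : IsPPSaturated L κ B) {G : Set (A × B)} (hG : GoodGraph L G)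
    (hcard : #G < κ) (x : A) : ∃ c : B, GoodGraph L (insert (x, c) G) := by
  classical
  obtain ⟨c, hc⟩ := hB G hcard (fun z => z.1.2)
    {φ | IsPP φ ∧ φ.Realize (Sum.elim (fun z : G => z.1.1) fun _ => x)} (fun φ h => h.1) (by
    intro s hs
    obtain ⟨ψ, hψ, hA, hB'⟩ := exists_pp_conj (A := A) (B := B) s (fun φ h => (hs h).1)
    have key : ∀ {M : Type w} [L.Structure M] (v : G → M),
        Formula.Realize (BoundedFormula.ex (n := 0) (BoundedFormula.relabel (n := 1) (k := 0)
          (Sum.map id (fun _ => (0 : Fin 1)) : G ⊕ Unit → G ⊕ Fin 1) ψ)) v ↔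
        ∃ m : M, ψ.Realize (Sum.elim v fun _ => m) := by
      intro M _ v
      rw [Formula.Realize, BoundedFormula.realize_ex]
      refine exists_congr fun m => ?_
      refine (BoundedFormula.realize_relabel (m := 1) (n := 0)).trans ?_
      rw [Formula.Realize]
      refine iff_of_eq ?_
      congr 1
      · funext z
        rcases z with z | z
        · rfl
        · simp [Fin.snoc]
      · exact Subsingleton.elim _ _
    obtain ⟨m, hm⟩ := (key _).1 (hG _ (.ex (hψ.relabel' _))
      ((key _).2 ⟨x, (hA _).2 fun φ h => (hs h).2⟩))
    exact ⟨m, (hB' _).1 hm⟩)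
  refine ⟨c, fun φ hφ hr => ?_⟩
  let g : (insert (x, c) G : Set (A × B)) → G ⊕ Unit := fun z =>
    if h : z.1 ∈ G then Sum.inl ⟨z.1, h⟩ else Sum.inr ()
  have hz : ∀ z : (insert (x, c) G : Set (A × B)), z.1 ∉ G → z.1 = (x, c) :=
    fun z h => z.2.resolve_right h
  have e1 : (Sum.elim (fun z : G => z.1.1) fun _ => x) ∘ g = fun z => z.1.1 := by
    funext z
    by_cases h : z.1 ∈ G
    · simp [g, h]
    · have h2 := hz z h
      simp only [Function.comp_apply, g, dif_neg h, Sum.elim_inr]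
      rw [h2]
  have e2 : (Sum.elim (fun z : G => z.1.2) fun _ => c) ∘ g = fun z => z.1.2 := by
    funext z
    by_cases h : z.1 ∈ G
    · simp [g, h]
    · have h2 := hz z h
      simp only [Function.comp_apply, g, dif_neg h, Sum.elim_inr]
      rw [h2]
  have := hc (φ.relabel g) ⟨hφ.relabel' _, by rw [Formula.realize_relabel, e1]; exact hr⟩
  rw [Formula.realize_relabel, e2] at this
  exact this

theorem GoodGraph.functional {A B : Type w} [L.Structure A] [L.Structure B]
    {G : Set (A × B)} (hG : GoodGraph L G) {y z : A × B} (hy : y ∈ G) (hz : z ∈ G)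
    (h : y.1 = z.1) : y = z := by
  have := hG (BoundedFormula.equal (Term.var (Sum.inl ⟨y, hy⟩)) (Term.var (Sum.inl ⟨z, hz⟩)))
    (.equal _ _) (by simpa [Formula.Realize, BoundedFormula.Realize] using h)
  exact Prod.ext h (by simpa [Formula.Realize, BoundedFormula.Realize] using this)

/-- If `B` is pp-`|A|`-saturated and `f : {a_α} → B` preserves all
pp-sentences with constants `c_α` from `(A; ⟨a_α⟩)` to `(B; ⟨f a_α⟩)`, then `f`
extends to a homomorphism from `A` to `B`. -/
theorem pp_saturated_hom_extension {L : FirstOrder.Language.{u, v}} [L.IsRelational]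
    {A B : Type w} [L.Structure A] [L.Structure B]
    (hB : IsPPSaturated L (#A) B)
    (ι : Type w) (hι : #ι < #A) (a : ι → A) (b : ι → B)
    (hpres : ∀ φ : L.Formula ι, IsPP φ → φ.Realize a → φ.Realize b) :
    ∃ g : A →[L] B, ∀ i, g (a i) = b i := by
  classical
  obtain ⟨r, wo, hr⟩ := Cardinal.exists_ord_eq A
  let G₀ : Set (A × B) := Set.range fun i => (a i, b i)
  have hG₀ : GoodGraph L G₀ := by
    intro φ hφ h
    let g : G₀ → ι := fun z => z.2.choose
    have hg : ∀ z : G₀, (a (g z), b (g z)) = z.1 := fun z => z.2.choose_spec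
    have e1 : a ∘ g = fun z => z.1.1 := funext fun z => congrArg Prod.fst (hg z)
    have e2 : b ∘ g = fun z => z.1.2 := funext fun z => congrArg Prod.snd (hg z)
    have := hpres (φ.relabel g) (hφ.relabel' _) (by rw [Formula.realize_relabel, e1]; exact h)
    rw [Formula.realize_relabel, e2] at this
    exact this
  let S : Set (Set (A × B)) := {G | GoodGraph L G ∧ ∀ z ∈ G, z.1 ∈ Set.range a ∨
    ∀ y, r y z.1 → ∃ w ∈ G, w.1 = y}
  obtain ⟨G, hsub, hmax⟩ := zorn_subset_nonempty S (by
    intro c hcS hc hne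
    refine ⟨⋃₀ c, ⟨GoodGraph.sUnion hc hne fun G hG => (hcS hG).1, ?_⟩,
      fun s hs => Set.subset_sUnion_of_mem hs⟩
    rintro z ⟨G, hG, hz⟩
    refine ((hcS hG).2 z hz).imp_right fun h y hy => ?_
    obtain ⟨w, hw, e⟩ := h y hy
    exact ⟨w, ⟨G, hG, hw⟩, e⟩) G₀ ⟨hG₀, by
      rintro _ ⟨i, rfl⟩
      exact Or.inl ⟨i, rfl⟩⟩
  obtain ⟨hgood, hinit⟩ := hmax.prop
  have htot : ∀ x, ∃ w ∈ G, w.1 = x := by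
    by_contra hcon
    rw [not_forall] at hcon
    obtain ⟨x, hx, hmin⟩ := (wo.wf).has_min {x | ¬ ∃ w ∈ G, w.1 = x} hcon
    have hlt : ∀ y, r y x → ∃ w ∈ G, w.1 = y := fun y hy => by
      by_contra h; exact hmin y h hy
    have hinj : Set.InjOn Prod.fst G := fun y hy z hz h => hgood.functional hy hz h
    have hcard : #G < #A := by
      rw [← Cardinal.mk_image_eq_of_injOn Prod.fst G hinj]
      have hxD : x ∉ Prod.fst '' G := hx
      rcases lt_or_ge (#A) ℵ₀ with hfin | hinf
      · have : Finite A := Cardinal.lt_aleph0_iff_finite.1 hfin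
        have : Fintype A := Fintype.ofFinite A
        have h1 : Fintype.card (Prod.fst '' G : Set A) < Fintype.card A :=
          Fintype.card_subtype_lt hxD
        rw [Cardinal.mk_fintype, Cardinal.mk_fintype]
        exact_mod_cast h1
      · have hD : Prod.fst '' G ⊆ Set.range a ∪ {y | r y x} := by
          rintro _ ⟨z, hz, rfl⟩
          rcases hinit z hz with h | h
          · exact Or.inl h
          · refine Or.inr ?_
            rcases trichotomous_of r z.1 x with h' | h' | h'
            · exact h'
            · exact absurd ⟨z, hz, h'⟩ hx
            · exact absurd (h x h') hx
        refine (Cardinal.mk_le_mk_of_subset hD).trans_lt ((Cardinal.mk_union_le _ _).trans_lt ?_)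
        refine Cardinal.add_lt_of_lt hinf (Cardinal.mk_range_le.trans_lt hι) ?_
        exact Cardinal.card_typein_lt x hr
    obtain ⟨c, hc⟩ := hgood.extend hB hcard x
    have hmem : insert (x, c) G ∈ S := by
      refine ⟨hc, ?_⟩
      rintro z (rfl | hz)
      · refine Or.inr fun y hy => ?_
        obtain ⟨w, hw, e⟩ := hlt y hy
        exact ⟨w, Or.inr hw, e⟩
      · refine (hinit z hz).imp_right fun h y hy => ?_
        obtain ⟨w, hw, e⟩ := h y hy
        exact ⟨w, Or.inr hw, e⟩
    exact hx ⟨(x, c), hmax.le_of_ge hmem (Set.subset_insert _ _) (Set.mem_insert _ _), rfl⟩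
  choose w hw hw1 using htot
  refine ⟨⟨fun x => (w x).2, fun f => isEmptyElim f, fun {n} R xs hR => ?_⟩, fun i => ?_⟩
  · have := hgood (BoundedFormula.rel R fun i => Term.var (Sum.inl ⟨w (xs i), hw _⟩))
      (.rel _ _) (by simpa [Formula.Realize, BoundedFormula.Realize, hw1] using hR)
    simpa [Formula.Realize, BoundedFormula.Realize, Function.comp_def] using this
  · have := hgood.functional (hw (a i)) (hsub ⟨i, rfl⟩) (hw1 (a i))
    exact congrArg Prod.snd this

end PaperCSP
end

section
/- Let A be a countable model, over a countable relational signature, of a set T of positively restricted ∀₂ sentences. Then there is a homomorphism from A to a countable model B of T that is existential-positively closed for T. -/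
open FirstOrder FirstOrder.Language Cardinal

universe u v w

namespace PaperCSP

variable {L : FirstOrder.Language.{u, v}}

/-- Positive boolean combinations of existential positive formulas and
negated atomic formulas. -/
inductive IsPRMatrix {α : Type w} {n : ℕ} : L.BoundedFormula α n → Prop
  | ep {φ : L.BoundedFormula α n} : IsEP φ → IsPRMatrix φ
  | negAtomic {φ : L.BoundedFormula α n} : φ.IsAtomic → IsPRMatrix φ.not
  | inf {φ ψ : L.BoundedFormula α n} : IsPRMatrix φ → IsPRMatrix ψ → IsPRMatrix (φ ⊓ ψ)
  | sup {φ ψ : L.BoundedFormula α n} : IsPRMatrix φ → IsPRMatrix ψ → IsPRMatrix (φ ⊔ ψ)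

/-- A positively restricted `∀₂` sentence: a universally quantified positive boolean
combination of existential positive formulas and negated atomic formulas. -/
def IsPosRestrictedForallTwo (σ : L.Sentence) : Prop :=
  ∃ (n : ℕ) (φ : L.BoundedFormula Empty n), IsPRMatrix φ ∧ σ = φ.alls


/-! ### Helper material -/

theorem IsPP.isEP {α : Type*} {n : ℕ} {φ : L.BoundedFormula α n} (h : IsPP φ) : IsEP φ := by
  induction h with
  | falsum => exact IsEP.falsum
  | equal t₁ t₂ => exact IsEP.equal t₁ t₂
  | rel R ts => exact IsEP.rel R ts
  | inf _ _ h1 h2 => exact IsEP.inf h1 h2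
  | ex _ h => exact IsEP.ex h

theorem IsEP.map_hom {α : Type*} {M N : Type*} [L.Structure M] [L.Structure N] (g : M →[L] N)
    {n : ℕ} {φ : L.BoundedFormula α n} (h : IsEP φ) :
    ∀ (v : α → M) (xs : Fin n → M), φ.Realize v xs → φ.Realize (g ∘ v) (g ∘ xs) := by
  induction h with
  | falsum => intro v xs h; exact h
  | equal t₁ t₂ =>
    intro v xs h
    simp only [BoundedFormula.Realize, ← Sum.comp_elim, HomClass.realize_term] at h ⊢
    rw [h]
  | rel R ts =>
    intro v xs h
    simp only [BoundedFormula.Realize, ← Sum.comp_elim, HomClass.realize_term] at h ⊢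
    exact g.map_rel R _ h
  | inf _ _ h1 h2 =>
    intro v xs h
    rw [BoundedFormula.realize_inf] at h ⊢
    exact ⟨h1 v xs h.1, h2 v xs h.2⟩
  | sup _ _ h1 h2 =>
    intro v xs h
    rw [BoundedFormula.realize_sup] at h ⊢
    exact h.imp (h1 v xs) (h2 v xs)
  | ex _ ih =>
    intro v xs h
    rw [BoundedFormula.realize_ex] at h ⊢
    obtain ⟨a, ha⟩ := h
    refine ⟨g a, ?_⟩
    rw [← Fin.comp_snoc]
    exact ih v _ ha

theorem IsPP.map_hom {α : Type*} {M N : Type*} [L.Structure M] [L.Structure N] (g : M →[L] N)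
    {φ : L.Formula α} (h : IsPP φ) (v : α → M) (hv : φ.Realize v) :
    φ.Realize (fun i => g (v i)) := by
  have := h.isEP.map_hom g v _ hv
  rw [Subsingleton.elim (g ∘ (default : Fin 0 → M)) default] at this
  exact this

section Chain

variable {F : ℕ → Type w} [∀ n, L.Structure (F n)] (f : ∀ n, F n →[L] F (n + 1))

/-- Transition maps of a chain. -/
def tr {i j : ℕ} (h : i ≤ j) : F i →[L] F j :=
  Nat.leRecOn (C := fun j => F i →[L] F j) h (fun {k} g => (f k).comp g) (Hom.id L (F i))

theorem tr_self (i : ℕ) (x : F i) : tr f (le_refl i) x = x := by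
  unfold tr
  rw [Nat.leRecOn_self]; rfl

theorem tr_succ {i j : ℕ} (h : i ≤ j) (x : F i) :
    tr f (h.trans (Nat.le_succ j)) x = f j (tr f h x) := by
  unfold tr
  rw [Nat.leRecOn_succ h]; rfl

theorem tr_tr {i j k : ℕ} (h : i ≤ j) (h' : j ≤ k) (x : F i) :
    tr f h' (tr f h x) = tr f (h.trans h') x := by
  induction k, h' using Nat.le_induction with
  | base => rw [tr_self]
  | succ k hk ih => rw [tr_succ f hk, ih, ← tr_succ]

/-- The setoid defining the limit of a chain. -/
def chainSetoid : Setoid (Σ n, F n) where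
  r x y := ∃ (k : ℕ) (hx : x.1 ≤ k) (hy : y.1 ≤ k), tr f hx x.2 = tr f hy y.2
  iseqv :=
    { refl := fun x => ⟨x.1, le_rfl, le_rfl, rfl⟩
      symm := fun ⟨k, hx, hy, h⟩ => ⟨k, hy, hx, h.symm⟩
      trans := by
        rintro x y z ⟨k, hx, hy, h⟩ ⟨l, hy', hz, hh⟩
        refine ⟨max k l, hx.trans (le_max_left _ _), hz.trans (le_max_right _ _), ?_⟩
        rw [← tr_tr f hx (le_max_left k l), h, tr_tr, ← tr_tr f hy' (le_max_right k l), hh, tr_tr] }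

/-- The limit of a chain. -/
def ChainLim : Type w := Quotient (chainSetoid f)

/-- The maps into the limit. -/
def toLim (n : ℕ) (x : F n) : ChainLim f := Quotient.mk (chainSetoid f) ⟨n, x⟩

theorem toLim_eq {i j : ℕ} {x : F i} {y : F j} :
    toLim f i x = toLim f j y ↔
      ∃ (k : ℕ) (hx : i ≤ k) (hy : j ≤ k), tr f hx x = tr f hy y :=
  Quotient.eq (r := chainSetoid f) (x := ⟨i, x⟩) (y := ⟨j, y⟩)

theorem toLim_tr {i j : ℕ} (h : i ≤ j) (x : F i) : toLim f j (tr f h x) = toLim f i x :=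
  (toLim_eq f).2 ⟨j, le_rfl, h, tr_self f j _⟩

theorem exists_toLim (b : ChainLim f) : ∃ n x, toLim f n x = b := by
  induction b using Quotient.inductionOn with
  | h a => exact ⟨a.1, a.2, rfl⟩

theorem exists_toLim_tuple {k : ℕ} (b : Fin k → ChainLim f) :
    ∃ n, ∃ x : Fin k → F n, (fun i => toLim f n (x i)) = b := by
  choose n x h using fun i => exists_toLim f (b i)
  have hn : ∀ i, n i ≤ Finset.univ.sup n := fun i => Finset.le_sup (Finset.mem_univ i)
  exact ⟨Finset.univ.sup n, fun i => tr f (hn i) (x i), funext fun i => by rw [toLim_tr, h]⟩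

variable [L.IsRelational]

instance chainStructure : L.Structure (ChainLim f) where
  funMap g := isEmptyElim g
  RelMap r x := ∃ n a, (fun i => toLim f n (a i)) = x ∧ Structure.RelMap r a

/-- The maps into the limit, as homomorphisms. -/
def toLimHom (n : ℕ) : F n →[L] ChainLim f where
  toFun := toLim f n
  map_fun' g := isEmptyElim g
  map_rel' _ x h := ⟨n, x, rfl, h⟩

theorem relMap_lim {i m : ℕ} (r : L.Relations m) (x : Fin m → F i)
    (h : Structure.RelMap r (fun l => toLim f i (x l))) :
    ∃ (k : ℕ) (hk : i ≤ k), Structure.RelMap r (fun l => tr f hk (x l)) := by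
  obtain ⟨n, a, hax, ha⟩ := h
  choose k hx hy h using fun l => (toLim_eq f).1 (congrFun hax l)
  let K := max (max n i) (Finset.univ.sup k)
  have hK : ∀ l, k l ≤ K := fun l =>
    (Finset.le_sup (Finset.mem_univ l)).trans (le_max_right _ _)
  have hnK : n ≤ K := (le_max_left _ _).trans (le_max_left _ _)
  have hiK : i ≤ K := (le_max_right _ _).trans (le_max_left _ _)
  refine ⟨K, hiK, ?_⟩
  have : (fun l => tr f hiK (x l)) = fun l => tr f hnK (a l) := by
    funext l
    rw [← tr_tr f (hy l) (hK l), ← h l, tr_tr]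
  rw [this]
  exact (tr f hnK).map_rel r a ha

theorem atomic_lim {i m : ℕ} {φ : L.BoundedFormula Empty m} (hφ : φ.IsAtomic)
    (v : Empty → F i) (x : Fin m → F i) (h : φ.Realize (toLimHom f i ∘ v) (toLimHom f i ∘ x)) :
    ∃ (k : ℕ) (hk : i ≤ k), φ.Realize (tr f hk ∘ v) (tr f hk ∘ x) := by
  cases hφ with
  | equal t₁ t₂ =>
    simp only [BoundedFormula.realize_bdEqual, ← Sum.comp_elim, HomClass.realize_term] at h ⊢
    obtain ⟨k, hk, _, h⟩ := (toLim_eq f).1 h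
    exact ⟨k, hk, h⟩
  | rel R ts =>
    simp only [BoundedFormula.realize_rel, ← Sum.comp_elim, HomClass.realize_term] at h ⊢
    exact relMap_lim f R _ h

theorem IsAtomic_isEP {m : ℕ} {φ : L.BoundedFormula Empty m} (hφ : φ.IsAtomic) : IsEP φ := by
  cases hφ with
  | equal t₁ t₂ => exact IsEP.equal t₁ t₂
  | rel R ts => exact IsEP.rel R ts

theorem matrix_lim {i m : ℕ} {φ : L.BoundedFormula Empty m} (hφ : IsPRMatrix φ)
    (v : Empty → F i) (x : Fin m → F i)
    (h : ∃ᶠ k in Filter.atTop, ∃ hk : i ≤ k, φ.Realize (tr f hk ∘ v) (tr f hk ∘ x)) :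
    φ.Realize (toLimHom f i ∘ v) (toLimHom f i ∘ x) := by
  induction hφ with
  | ep h1 =>
    obtain ⟨k, hk, h⟩ := h.exists
    have := h1.map_hom (toLimHom f k) _ _ h
    have e : toLimHom f k ∘ tr f hk ∘ x = toLimHom f i ∘ x :=
      funext fun l => toLim_tr f hk (x l)
    rw [e] at this
    convert this
  | negAtomic ha =>
    rw [BoundedFormula.realize_not]
    intro hr
    obtain ⟨k, hk, hr⟩ := atomic_lim f ha v x hr
    obtain ⟨j, hj, hij, h⟩ := (Filter.frequently_atTop.1 h) k
    rw [BoundedFormula.realize_not] at h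
    apply h
    have := (IsAtomic_isEP ha).map_hom (tr f hj) _ _ hr
    have e : tr f hj ∘ tr f hk ∘ x = tr f hij ∘ x := funext fun l => tr_tr f hk hj (x l)
    rw [e] at this
    convert this
  | inf _ _ h1 h2 =>
    simp only [BoundedFormula.realize_inf] at h ⊢
    exact ⟨h1 (h.mono fun k ⟨hk, h⟩ => ⟨hk, h.1⟩), h2 (h.mono fun k ⟨hk, h⟩ => ⟨hk, h.2⟩)⟩
  | sup _ _ h1 h2 =>
    simp only [BoundedFormula.realize_sup, exists_or, Filter.frequently_or_distrib] at h ⊢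
    exact h.imp h1 h2

theorem model_lim (T : L.Theory) (hT : ∀ σ ∈ T, IsPosRestrictedForallTwo σ)
    (hF : ∀ n, F n ⊨ T) : ChainLim f ⊨ T := by
  rw [Theory.model_iff]
  intro σ hσ
  obtain ⟨n, φ, hφ, rfl⟩ := hT σ hσ
  rw [Sentence.Realize, BoundedFormula.realize_alls]
  intro b
  obtain ⟨i, x, rfl⟩ := exists_toLim_tuple f b
  have := matrix_lim f hφ (default : Empty → F i) x (by
    refine Filter.Eventually.frequently ?_
    filter_upwards [Filter.eventually_ge_atTop i] with k hk
    refine ⟨hk, ?_⟩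
    have h := (Theory.model_iff _).1 (hF k) _ hσ
    rw [Sentence.Realize, BoundedFormula.realize_alls] at h
    convert h (tr f hk ∘ x))
  rw [Subsingleton.elim (toLimHom f i ∘ (default : Empty → F i)) default] at this
  exact this

theorem exists_chain_lim (T : L.Theory) (hT : ∀ σ ∈ T, IsPosRestrictedForallTwo σ)
    (hF : ∀ n, F n ⊨ T) [∀ n, Countable (F n)] :
    ∃ (B : Type w) (_ : L.Structure B), Countable B ∧ B ⊨ T ∧
      ∃ g : ∀ n, F n →[L] B, (∀ n x, g (n + 1) (f n x) = g n x) ∧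
        ∀ (k : ℕ) (b : Fin k → B), ∃ n, ∃ x : Fin k → F n, (fun i => g n (x i)) = b := by
  refine ⟨ChainLim f, chainStructure f, ?_, model_lim f T hT hF, toLimHom f, ?_, ?_⟩
  · unfold ChainLim; infer_instance
  · intro n x
    have := toLim_tr f (Nat.le_succ n) x
    have e := tr_succ f (le_refl n) x
    rw [tr_self] at e
    rw [← e]
    exact this
  · exact fun k b => exists_toLim_tuple f b

end Chain

theorem exists_countable_sub [Countable L.Symbols] (T : L.Theory)
    (M N : Type w) [L.Structure M] [Countable M] [L.Structure N] (hN : N ⊨ T) (h : M →[L] N)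
    {k : ℕ} (φ : L.Formula (Fin k)) (a : Fin k → M) (hφ : φ.Realize (fun i => h (a i))) :
    ∃ (P : Type w) (_ : L.Structure P), Countable P ∧ P ⊨ T ∧
      ∃ g : M →[L] P, φ.Realize (fun i => g (a i)) := by
  by_cases hc : Countable N
  · exact ⟨N, inferInstance, hc, hN, h, hφ⟩
  · have hL : L.card ≤ ℵ₀ := Cardinal.mk_le_aleph0_iff.2 ‹_›
    obtain ⟨S, hS, hcard⟩ := exists_elementarySubstructure_card_eq L (Set.range h) (ℵ₀ : Cardinal.{w})
      le_rfl (by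
        rw [Cardinal.lift_le]
        exact Cardinal.mk_le_aleph0_iff.2 (Set.countable_range h).to_subtype) (by simpa using hL) (by
        rw [Cardinal.lift_le]
        rw [← not_lt, Cardinal.lt_aleph0_iff_finite]
        intro hf
        exact hc inferInstance)
    rw [Cardinal.lift_inj] at hcard
    let g : M →[L] S := h.codRestrict S.toSubstructure (fun c => hS ⟨c, rfl⟩)
    refine ⟨S, inferInstance, Cardinal.mk_le_aleph0_iff.1 hcard.le, ?_, g, ?_⟩
    · exact (S.theory_model_iff T).2 hN
    · exact (S.isElementary φ (fun i => g (a i))).1 hφ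

/-- Countable models of `T`. -/
structure CM (T : L.Theory) where
  /-- carrier -/
  C : Type w
  [str : L.Structure C]
  [cnt : Countable C]
  mod : C ⊨ T

attribute [instance] CM.str CM.cnt

theorem one_step [Countable L.Symbols] (T : L.Theory) (N : CM.{u, v, w} T) (k : ℕ)
    (φ : L.Formula (Fin k)) (a : Fin k → N.C) :
    ∃ (P : CM.{u, v, w} T) (g : N.C →[L] P.C), ∀ (Q : Type w) [L.Structure Q], Q ⊨ T →
      ∀ h : P.C →[L] Q, φ.Realize (fun i => h (g (a i))) → φ.Realize (fun i => g (a i)) := by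
  by_cases H : ∃ (Q : Type w) (_ : L.Structure Q), Q ⊨ T ∧
      ∃ h : N.C →[L] Q, φ.Realize (fun i => h (a i))
  · obtain ⟨Q, _, hQ, h, hφ⟩ := H
    obtain ⟨P, _, hc, hP, g, hg⟩ := exists_countable_sub T N.C Q hQ h φ a hφ
    exact ⟨⟨P, hP⟩, g, fun _ _ _ _ _ => hg⟩
  · exact ⟨N, Hom.id L _, fun Q _ hQ h hφ => (H ⟨Q, _, hQ, h, hφ⟩).elim⟩

theorem full_step [L.IsRelational] [Countable L.Symbols] (T : L.Theory)
    (hT : ∀ σ ∈ T, IsPosRestrictedForallTwo σ) (M : CM.{u, v, w} T) :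
    ∃ (P : CM.{u, v, w} T) (g : M.C →[L] P.C), ∀ (k : ℕ) (φ : L.Formula (Fin k)), IsPP φ →
      ∀ (a : Fin k → M.C) (Q : Type w) [L.Structure Q], Q ⊨ T →
      ∀ h : P.C →[L] Q, φ.Realize (fun i => h (g (a i))) → φ.Realize (fun i => g (a i)) := by
  choose next g hg using one_step (L := L) T
  have : Nonempty (Σ k, L.Formula (Fin k) × (Fin k → M.C)) :=
    ⟨⟨0, BoundedFormula.falsum, Fin.elim0⟩⟩
  obtain ⟨e, he⟩ := exists_surjective_nat (Σ k, L.Formula (Fin k) × (Fin k → M.C))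
  let s : ℕ → Σ N : CM.{u, v, w} T, (M.C →[L] N.C) := fun n => Nat.rec
    ⟨M, Hom.id L _⟩
    (fun n s => ⟨next s.1 (e n).1 (e n).2.1 (fun i => s.2 ((e n).2.2 i)),
      (g s.1 (e n).1 (e n).2.1 (fun i => s.2 ((e n).2.2 i))).comp s.2⟩) n
  let f : ∀ n, (s n).1.C →[L] (s (n + 1)).1.C := fun n =>
    g (s n).1 (e n).1 (e n).2.1 (fun i => (s n).2 ((e n).2.2 i))
  have hf : ∀ n x, (s (n + 1)).2 x = f n ((s n).2 x) := fun n x => rfl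
  obtain ⟨B, _, hBc, hB, G, hG, -⟩ := exists_chain_lim f T hT (fun n => (s n).1.mod)
  have hG0 : ∀ n x, G n ((s n).2 x) = G 0 x := by
    intro n x
    induction n with
    | zero => rfl
    | succ n ih => rw [hf, hG, ih]
  refine ⟨⟨B, hB⟩, G 0, ?_⟩
  intro k φ hφ a Q _ hQ h hr
  have main : ∀ n, IsPP (e n).2.1 → (e n).2.1.Realize (fun i => h (G 0 ((e n).2.2 i))) →
      (e n).2.1.Realize (fun i => G 0 ((e n).2.2 i)) := by
    intro n hφ hr
    have key := hg (s n).1 (e n).1 (e n).2.1 (fun i => (s n).2 ((e n).2.2 i)) Q hQ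
      (h.comp (G (n + 1)))
    change Formula.Realize _ (fun i => h (G (n + 1) (f n _))) →
      Formula.Realize _ (fun i => f n _) at key
    simp only [hG, hG0] at key
    have := hφ.map_hom (G (n + 1)) _ (key hr)
    simpa only [hG, hG0] using this
  obtain ⟨n, hn⟩ := he ⟨k, φ, a⟩
  have := main n
  rw [hn] at this
  exact this hφ hr

/-- Every countable model `A` of a set `T` of positively restricted
`∀₂` sentences (over a countable relational signature) admits a homomorphism to a
countable epc model `B` of `T`. -/
theorem exists_epc_model {L : FirstOrder.Language.{u, v}} [L.IsRelational]
    [Countable L.Symbols]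
    (T : L.Theory) (hT : ∀ σ ∈ T, IsPosRestrictedForallTwo σ)
    (A : Type w) [L.Structure A] [Countable A] (hA : A ⊨ T) :
    ∃ (B : Type w) (S : L.Structure B), letI := S
      Countable B ∧ B ⊨ T ∧ IsEPC T B ∧ Nonempty (A →[L] B) := by
  choose next g hg using fun M : CM.{u, v, w} T => full_step T hT M
  let s : ℕ → CM.{u, v, w} T := fun n =>
    Nat.rec (motive := fun _ => CM.{u, v, w} T) (CM.mk A hA) (fun _ N => next N) n
  let f : ∀ n, (s n).C →[L] (s (n + 1)).C := fun n => g (s n)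
  obtain ⟨B, S, hBc, hB, G, hG, hsurj⟩ := exists_chain_lim f T hT (fun n => (s n).mod)
  refine ⟨B, S, hBc, hB, ⟨hB, ?_⟩, ⟨G 0⟩⟩
  intro Q _ hQ h k φ hφ b hr
  obtain ⟨n, a, rfl⟩ := hsurj k b
  have key := hg (s n) k φ hφ a Q hQ (h.comp (G (n + 1)))
  change φ.Realize (fun i => h (G (n + 1) (f n (a i)))) → φ.Realize (fun i => f n (a i)) at key
  simp only [hG] at key
  have := hφ.map_hom (G (n + 1)) (fun i => f n (a i)) (key hr)
  simpa only [hG] using this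

end PaperCSP
end

section
/- Consider the structure (ℚ_{≥0}; <), where ℚ_{≥0} = {q ∈ ℚ : q ≥ 0} and < is the usual strict order. Every endomorphism of (ℚ_{≥0}; <) is an embedding (i.e., (ℚ_{≥0}; <) is a core), but (ℚ_{≥0}; <) is not existential-positively closed for its primitive positive theory pp-Th(ℚ_{≥0}; <). -/
open FirstOrder FirstOrder.Language Cardinal

universe u v w

namespace PaperCSP

variable {L : FirstOrder.Language.{u, v}}

/-- A signature with a single binary relation. -/
inductive OrdRel : ℕ → Type
  | lt : OrdRel 2

/-- The relational language with a single binary relation symbol. -/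
def OrdLang : FirstOrder.Language := ⟨fun _ => Empty, OrdRel⟩

/-- The nonnegative rationals. -/
abbrev QNonneg : Type := {q : ℚ // 0 ≤ q}

/-- The structure `(ℚ_{≥0}; <)`. -/
instance : OrdLang.Structure QNonneg where
  funMap := fun f _ => f.elim
  RelMap := fun {n} r => match r with
    | .lt => fun x => (x 0 : ℚ) < (x 1 : ℚ)


theorem relMap_lt_iff (x : Fin 2 → QNonneg) :
    Structure.RelMap (L := OrdLang) (OrdRel.lt : OrdLang.Relations 2) x ↔
      (x 0 : ℚ) < (x 1 : ℚ) := Iff.rfl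

theorem hom_strictMono (h : QNonneg →[OrdLang] QNonneg) : StrictMono h := by
  intro a b hab
  have := h.map_rel (OrdRel.lt : OrdLang.Relations 2) ![a, b]
    ((relMap_lt_iff _).2 hab)
  exact (relMap_lt_iff _).1 this

/-- The endomorphism `x ↦ x + 1`. -/
def shiftHom : QNonneg →[OrdLang] QNonneg where
  toFun x := ⟨x.1 + 1, by have := x.2; linarith⟩
  map_fun' := fun f _ => Empty.elim f
  map_rel' := by
    intro n r x hx
    change OrdRel n at r
    cases r
    have hx' : (x 0 : ℚ) < (x 1 : ℚ) := hx
    change (x 0 : ℚ) + 1 < (x 1 : ℚ) + 1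
    linarith

/-- The formula `∃ y, y < x`. -/
def belowBody : OrdLang.BoundedFormula (Fin 1) 1 :=
  BoundedFormula.rel (OrdRel.lt : OrdLang.Relations 2)
    ![Term.var (Sum.inr 0), Term.var (Sum.inl 0)]

theorem realize_below (a : Fin 1 → QNonneg) :
    Formula.Realize (belowBody.ex : OrdLang.Formula (Fin 1)) a ↔ ∃ y : QNonneg, y < a 0 := by
  unfold Formula.Realize
  rw [BoundedFormula.realize_ex]
  exact Iff.rfl

theorem qNonneg_models : QNonneg ⊨ ppTheory OrdLang QNonneg := by
  rw [Theory.model_iff]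
  rintro σ (⟨_, h⟩ | ⟨φ, _, h, rfl⟩)
  · exact h
  · exact h

/-- `(ℚ_{≥0}; <)` is a core but is not epc for its pp-theory. -/
theorem qNonneg_core_not_epc :
    IsCore OrdLang QNonneg ∧
    ¬ IsEPC (ppTheory OrdLang QNonneg) QNonneg := by
  constructor
  · intro h
    refine ⟨(hom_strictMono h).injective, ?_⟩
    intro n r x hx
    change OrdRel n at r
    cases r
    exact (hom_strictMono h).lt_iff_lt.1 hx
  · rintro ⟨_, H⟩
    have h0 := H QNonneg qNonneg_models shiftHom 1 belowBody.ex
      (IsPP.ex (IsPP.rel _ _)) (fun _ => ⟨0, le_refl 0⟩)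
      ((realize_below _).2 ⟨⟨0, le_refl 0⟩, show (0 : ℚ) < 0 + 1 by norm_num⟩)
    obtain ⟨y, hy⟩ := (realize_below _).1 h0
    exact absurd (show (y : ℚ) < 0 from hy) (not_lt.2 y.2)

end PaperCSP
end

section
/- Let A be a countable homogeneous relational structure such that for each k only a finite number of distinct k-ary relations on A can be defined by atomic formulas. Then A is ω-categorical. -/
open FirstOrder FirstOrder.Language Cardinal

universe u v w

namespace PaperCSP

variable {L : FirstOrder.Language.{u, v}}

/-- A structure is homogeneous if every finite partial automorphism (an isomorphism
between finite substructures) extends to an automorphism. -/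
def IsHomogeneous (L : FirstOrder.Language.{u, v}) (A : Type w) [L.Structure A] : Prop :=
  ∀ (n : ℕ) (a b : Fin n → A), Function.Injective a → Function.Injective b →
    (∀ (ℓ : ℕ) (r : L.Relations ℓ) (ι : Fin ℓ → Fin n),
      Structure.RelMap r (a ∘ ι) ↔ Structure.RelMap r (b ∘ ι)) →
    ∃ g : A ≃[L] A, ∀ i, g (a i) = b i


/-- Universal closures of formulas transfer between a structure and the models of its theory. -/
theorem forall_transfer {L : FirstOrder.Language.{u, v}} (A M : Type w) [L.Structure A]
    [L.Structure M] [M ⊨ L.completeTheory A] {k : ℕ} (φ : L.Formula (Fin k)) :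
    (∀ x : Fin k → M, φ.Realize x) ↔ ∀ x : Fin k → A, φ.Realize x := by
  have h := realize_iff_of_model_completeTheory (L := L) A M
    (Formula.iAlls (Fin k) (φ.relabel (Sum.inr : Fin k → Empty ⊕ Fin k)))
  simp only [Sentence.Realize, Formula.realize_iAlls, Formula.realize_relabel] at h
  exact h

/-- Tuples satisfying the same atomic formulas are conjugate under automorphisms. -/
theorem exists_aut {L : FirstOrder.Language.{u, v}}
    (A : Type w) [L.Structure A] (hhom : IsHomogeneous L A) {k : ℕ} (x y : Fin k → A)
    (h : ∀ φ : L.Formula (Fin k), φ.IsAtomic → (φ.Realize x ↔ φ.Realize y)) :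
    ∃ g : A ≃[L] A, ∀ i, g (x i) = y i := by
  have heq : ∀ i j, x i = x j ↔ y i = y j := by
    intro i j
    have := h (Term.bdEqual (Term.var (Sum.inl i)) (Term.var (Sum.inl j)))
      (BoundedFormula.IsAtomic.equal _ _)
    simpa [Formula.Realize] using this
  have hrel : ∀ (ℓ : ℕ) (r : L.Relations ℓ) (ι : Fin ℓ → Fin k),
      Structure.RelMap r (x ∘ ι) ↔ Structure.RelMap r (y ∘ ι) := by
    intro ℓ r ι
    have := h (r.boundedFormula (fun i => Term.var (Sum.inl (ι i))))
      (BoundedFormula.IsAtomic.rel _ _)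
    simpa [Formula.Realize, BoundedFormula.realize_rel, Function.comp_def] using this
  obtain ⟨n, ⟨e⟩⟩ := Finite.exists_equiv_fin (Set.range x)
  choose s hs using fun i : Fin n => (e.symm i).2
  have hinj : Function.Injective (x ∘ s) := by
    intro i j hij
    simp only [Function.comp, hs] at hij
    exact e.symm.injective (Subtype.ext hij)
  obtain ⟨g, hg⟩ := hhom n (x ∘ s) (y ∘ s) hinj
    (fun i j hij => hinj ((heq _ _).2 hij))
    (fun ℓ r ι => hrel ℓ r (s ∘ ι))
  refine ⟨g, fun j => ?_⟩
  have hj : x (s (e ⟨x j, j, rfl⟩)) = x j := by simp [hs]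
  have := hg (e ⟨x j, j, rfl⟩)
  simp only [Function.comp] at this
  rw [hj] at this
  rw [this]
  exact (heq _ _).1 hj

/-- There are only finitely many definable `k`-ary relations. -/
theorem finite_definable {L : FirstOrder.Language.{u, v}}
    (A : Type w) [L.Structure A] (hhom : IsHomogeneous L A) (k : ℕ)
    (hfin : {R : Set (Fin k → A) |
      ∃ φ : L.Formula (Fin k), φ.IsAtomic ∧ R = {x | φ.Realize x}}.Finite) :
    {R : Set (Fin k → A) | FODefinable L A R}.Finite := by
  set D := {R : Set (Fin k → A) |
      ∃ φ : L.Formula (Fin k), φ.IsAtomic ∧ R = {x | φ.Realize x}} with hD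
  have : Finite D := hfin
  let t : (Fin k → A) → Set D := fun x => {R | x ∈ R.1}
  have key : ∀ R : Set (Fin k → A), FODefinable L A R → R = t ⁻¹' (t '' R) := by
    rintro R ⟨φ, rfl⟩
    refine Set.Subset.antisymm (Set.subset_preimage_image _ _) ?_
    rintro y ⟨x, hx, hxy⟩
    obtain ⟨g, hg⟩ := exists_aut A hhom x y (by
      intro ψ hψ
      have := Set.ext_iff.1 hxy ⟨{x | ψ.Realize x}, ψ, hψ, rfl⟩
      exact this)
    have hgy : y = g ∘ x := funext fun i => (hg i).symm
    change φ.Realize y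
    rw [hgy]
    exact (StrongHomClass.realize_formula g φ).2 hx
  refine Set.Finite.subset (Set.finite_range (fun S : Set (Set D) => t ⁻¹' S)) ?_
  intro R hR
  exact ⟨t '' R, (key R hR).symm⟩

/-- The extension step of the back-and-forth argument. -/
theorem extend_step {L : FirstOrder.Language.{u, v}} (A M N : Type w) [L.Structure A]
    [L.Structure M] [L.Structure N] [M ⊨ L.completeTheory A] [N ⊨ L.completeTheory A]
    (hdef : ∀ k, {R : Set (Fin k → A) | FODefinable L A R}.Finite) {n : ℕ}
    (a : Fin n → M) (b : Fin n → N)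
    (hab : ∀ φ : L.Formula (Fin n), φ.Realize a ↔ φ.Realize b) (c : M) :
    ∃ d : N, ∀ φ : L.Formula (Fin (n + 1)),
      φ.Realize (Fin.snoc a c : Fin (n + 1) → M) ↔
        φ.Realize (Fin.snoc b d : Fin (n + 1) → N) := by
  classical
  have : Finite {R : Set (Fin (n + 1) → A) | FODefinable L A R} := hdef (n + 1)
  choose f hf using fun R : {R : Set (Fin (n + 1) → A) | FODefinable L A R} => R.2
  let θ : L.Formula (Fin (n + 1)) := Formula.iInf fun R =>
    if (f R).Realize (Fin.snoc a c : Fin (n + 1) → M) then f R else (f R).not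
  let σ : Fin (n + 1) → Fin n ⊕ Fin 1 := finSumFinEquiv.symm
  have hσ : ∀ {P : Type w} (p : Fin n → P) (q : Fin 1 → P),
      (Sum.elim p q) ∘ σ = (Fin.snoc p (q 0) : Fin (n + 1) → P) := by
    intro P p q
    funext i
    refine Fin.lastCases ?_ (fun j => ?_) i
    · have : σ (Fin.last n) = Sum.inr 0 := finSumFinEquiv_symm_last
      simp [this]
    · have : σ (Fin.castSucc j) = Sum.inl j := finSumFinEquiv_symm_apply_castAdd j
      simp [this]
  have hM : (Formula.iExs (Fin 1) (θ.relabel σ)).Realize a := by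
    rw [Formula.realize_iExs]
    refine ⟨fun _ => c, ?_⟩
    rw [Formula.realize_relabel, hσ]
    rw [Formula.realize_iInf]
    intro R
    split_ifs with h
    · exact h
    · exact h
  have hN := (hab _).1 hM
  rw [Formula.realize_iExs] at hN
  obtain ⟨d, hd⟩ := hN
  rw [Formula.realize_relabel, hσ, Formula.realize_iInf] at hd
  refine ⟨d 0, fun φ => ?_⟩
  let R : {R : Set (Fin (n + 1) → A) | FODefinable L A R} := ⟨{x | φ.Realize x}, φ, rfl⟩
  have hA : ∀ x : Fin (n + 1) → A, (φ.iff (f R)).Realize x := by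
    intro x
    rw [Formula.realize_iff]
    exact Set.ext_iff.1 (hf R) x
  have h1 := (forall_transfer A M (φ.iff (f R))).2 hA (Fin.snoc a c)
  have h2 := (forall_transfer A N (φ.iff (f R))).2 hA (Fin.snoc b (d 0))
  rw [Formula.realize_iff] at h1 h2
  rw [h1, h2]
  have h3 := hd R
  split_ifs at h3 with h
  · exact iff_of_true h h3
  · exact iff_of_false h h3

/-- A set of pairs is good if it is a partial elementary map. -/
def Good (L : FirstOrder.Language.{u, v}) {M N : Type w} [L.Structure M] [L.Structure N]
    (S : Set (M × N)) : Prop :=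
  ∀ (n : ℕ) (p : Fin n → M × N), (∀ i, p i ∈ S) →
    ∀ φ : L.Formula (Fin n), φ.Realize (fun i => (p i).1) ↔ φ.Realize (fun i => (p i).2)

theorem Good.swap {L : FirstOrder.Language.{u, v}} {M N : Type w} [L.Structure M]
    [L.Structure N] {S : Set (M × N)} (h : Good L S) : Good L (Prod.swap ⁻¹' S) :=
  fun n p hp φ => (h n (fun i => (p i).swap) hp φ).symm

theorem Good.extend {L : FirstOrder.Language.{u, v}} (A : Type w) {M N : Type w} [L.Structure A]
    [L.Structure M] [L.Structure N] [M ⊨ L.completeTheory A] [N ⊨ L.completeTheory A]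
    (hdef : ∀ k, {R : Set (Fin k → A) | FODefinable L A R}.Finite)
    {S : Set (M × N)} (hS : S.Finite) (h : Good L S) (c : M) :
    ∃ d : N, Good L (insert (c, d) S) := by
  have : Finite S := hS
  obtain ⟨n, ⟨e⟩⟩ := Finite.exists_equiv_fin S
  obtain ⟨d, hd⟩ := extend_step A M N hdef (fun i => (e.symm i).1.1) (fun i => (e.symm i).1.2)
    (h n (fun i => (e.symm i).1) (fun i => (e.symm i).2)) c
  refine ⟨d, fun m p hp φ => ?_⟩
  have hs : ∀ i, ∃ j : Fin (n + 1),
      (p i).1 = (Fin.snoc (fun i => (e.symm i).1.1) c : Fin (n + 1) → M) j ∧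
      (p i).2 = (Fin.snoc (fun i => (e.symm i).1.2) d : Fin (n + 1) → N) j := by
    intro i
    rcases hp i with hi | hi
    · exact ⟨Fin.last n, by simp [hi]⟩
    · exact ⟨Fin.castSucc (e ⟨p i, hi⟩), by simp⟩
  choose s hs1 hs2 using hs
  have := hd (φ.relabel s)
  rw [Formula.realize_relabel, Formula.realize_relabel] at this
  rw [funext hs1, funext hs2]
  exact this

theorem Good.empty {L : FirstOrder.Language.{u, v}} (A M N : Type w) [L.Structure A]
    [L.Structure M] [L.Structure N] [M ⊨ L.completeTheory A] [N ⊨ L.completeTheory A] :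
    Good L (∅ : Set (M × N)) := by
  intro n p hp φ
  obtain rfl : n = 0 := by
    by_contra hn
    exact hp ⟨0, Nat.pos_of_ne_zero hn⟩
  have h := (forall_transfer A M φ).trans (forall_transfer A N φ).symm
  constructor
  · intro h1
    exact h.1 (fun x => by rwa [Subsingleton.elim x]) _
  · intro h1
    exact h.2 (fun x => by rwa [Subsingleton.elim x]) _

/-- A good total and surjective relation gives an isomorphism. -/
theorem Good.equiv {L : FirstOrder.Language.{u, v}} [L.IsRelational] {M N : Type w}
    [L.Structure M] [L.Structure N] {S : Set (M × N)} (h : Good L S)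
    (h1 : ∀ c : M, ∃ d, (c, d) ∈ S) (h2 : ∀ d : N, ∃ c, (c, d) ∈ S) :
    Nonempty (M ≃[L] N) := by
  have heq : ∀ c d c2 d2, (c, d) ∈ S → (c2, d2) ∈ S → (c = c2 ↔ d = d2) := by
    intro c d c2 d2 hc hc2
    have := h 2 ![(c, d), (c2, d2)] (by intro i; fin_cases i <;> assumption)
      (Term.bdEqual (Term.var (Sum.inl 0)) (Term.var (Sum.inl 1)))
    simpa [Formula.Realize] using this
  choose f hf using h1
  choose g hg using h2
  refine ⟨⟨⟨f, g, fun c => ?_, fun d => ?_⟩, fun {n} F => isEmptyElim F, fun {n} r x => ?_⟩⟩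
  · exact (heq _ _ _ _ (hg _) (hf _)).2 rfl
  · exact (heq _ _ _ _ (hf _) (hg _)).1 rfl
  · have := h n (fun i => (x i, f (x i))) (fun i => hf _)
      (r.boundedFormula (fun i => Term.var (Sum.inl i)))
    simp only [Formula.Realize, BoundedFormula.realize_rel, Term.realize_var, Sum.elim_inl] at this
    exact this.symm

/-- The back-and-forth argument. -/
theorem back_and_forth {L : FirstOrder.Language.{u, v}} [L.IsRelational] (A M N : Type w)
    [L.Structure A] [L.Structure M] [L.Structure N]
    [M ⊨ L.completeTheory A] [N ⊨ L.completeTheory A] [Countable M] [Countable N]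
    (hdef : ∀ k, {R : Set (Fin k → A) | FODefinable L A R}.Finite) :
    Nonempty (M ≃[L] N) := by
  let P := {S : Set (M × N) // S.Finite ∧ Good L S}
  have : Encodable (M ⊕ N) := Encodable.ofCountable _
  let 𝒟 : M ⊕ N → Order.Cofinal P := fun x => match x with
    | Sum.inl c => ⟨{S | ∃ d, (c, d) ∈ S.1}, fun S => by
        obtain ⟨d, hd⟩ := S.2.2.extend A hdef S.2.1 c
        exact ⟨⟨insert (c, d) S.1, S.2.1.insert _, hd⟩, ⟨d, Set.mem_insert _ _⟩,
          Set.subset_insert _ _⟩⟩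
    | Sum.inr d => ⟨{S | ∃ c, (c, d) ∈ S.1}, fun S => by
        obtain ⟨c, hc⟩ := S.2.2.swap.extend A hdef
          (S.2.1.preimage Prod.swap_injective.injOn) d
        refine ⟨⟨insert (c, d) S.1, S.2.1.insert _, ?_⟩, ⟨c, Set.mem_insert _ _⟩,
          Set.subset_insert _ _⟩
        convert hc.swap using 1
        ext ⟨x, y⟩
        simp [and_comm]⟩
  let p₀ : P := ⟨∅, Set.finite_empty, Good.empty A M N⟩
  let I := Order.idealOfCofinals p₀ 𝒟
  have hI : Good L {q : M × N | ∃ S ∈ I, q ∈ S.1} := by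
    intro n p hp φ
    choose S hS hpS using hp
    obtain ⟨U, hU, hSU⟩ : ∃ U ∈ I, ∀ i, S i ≤ U := by
      choose m hm using hS
      refine ⟨Order.sequenceOfCofinals p₀ 𝒟 (Finset.univ.sup m), ⟨_, le_rfl⟩, fun i => ?_⟩
      exact (hm i).trans
        (Order.sequenceOfCofinals.monotone p₀ 𝒟 (Finset.le_sup (Finset.mem_univ i)))
    exact U.2.2 n p (fun i => hSU i (hpS i)) φ
  refine hI.equiv (fun c => ?_) (fun d => ?_)
  · obtain ⟨S, ⟨d, hd⟩, hSI⟩ := Order.cofinal_meets_idealOfCofinals p₀ 𝒟 (Sum.inl c)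
    exact ⟨d, S, hSI, hd⟩
  · obtain ⟨S, ⟨c, hc⟩, hSI⟩ := Order.cofinal_meets_idealOfCofinals p₀ 𝒟 (Sum.inr d)
    exact ⟨c, S, hSI, hc⟩

/-- A countable homogeneous relational structure with only finitely
many atomically definable `k`-ary relations for each `k` is `ω`-categorical. -/
theorem homogeneous_omega_categorical {L : FirstOrder.Language.{u, v}} [L.IsRelational]
    (A : Type w) [L.Structure A] [Countable A]
    (hhom : IsHomogeneous L A)
    (hfin : ∀ k : ℕ, {R : Set (Fin k → A) |
      ∃ φ : L.Formula (Fin k), φ.IsAtomic ∧ R = {x | φ.Realize x}}.Finite) :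
    Cardinal.Categorical (ℵ₀ : Cardinal.{w}) (L.completeTheory A) := by
  intro M N hM hN
  have : Countable M := Cardinal.mk_le_aleph0_iff.1 hM.le
  have : Countable N := Cardinal.mk_le_aleph0_iff.1 hN.le
  exact back_and_forth A M N (fun k => finite_definable A hhom k (hfin k))

end PaperCSP
end
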